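/- Let e ∈ ℝ with |e| < 1, θ₀ ∈ ℝ, and J(θ) = ∫_{θ₀}^{θ} 1/ρ(τ)² dτ. Let Φ : ℝ → Matrix (Fin 4) (Fin 4) ℝ be defined by the rows [1, −c(1 + 1/ρ), s(1 + 1/ρ), 3ρ²J], [0, s, c, 2 − 3 e s J], [0, 2s, 2c − e, 3(1 − 2 e s J)], [0, s′, c′, −3e(s′ J + s/ρ²)], with all of ρ, s, c, s′, c′, J evaluated at θ. Then every entry of Φ is differentiable in θ and Φ′(θ) = A(θ) · Φ(θ), where A(θ) is the 4×4 matrix with rows [0, 0, 1, 0], [0, 0, 0, 1], [0, 0, 0, 2], [0, 3/ρ(θ), −2, 0]. -/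

import Mathlib

noncomputable section

/-- `ρ(θ) = 1 + e cos θ`. -/
def ρ (e θ : ℝ) : ℝ := 1 + e * Real.cos θ

/-- `s(θ) = ρ(θ) sin θ`. -/
def s (e θ : ℝ) : ℝ := ρ e θ * Real.sin θ

/-- `c(θ) = ρ(θ) cos θ`. -/
def c (e θ : ℝ) : ℝ := ρ e θ * Real.cos θ

/-- `s′(θ) = cos θ + e cos 2θ`. -/
def s' (e θ : ℝ) : ℝ := Real.cos θ + e * Real.cos (2 * θ)

/-- `c′(θ) = −(sin θ + e sin 2θ)`. -/
def c' (e θ : ℝ) : ℝ := -(Real.sin θ + e * Real.sin (2 * θ))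

/-- `J(θ) = ∫_{θ₀}^{θ} 1/ρ(τ)² dτ`. -/
def J (e θ₀ θ : ℝ) : ℝ := ∫ τ in θ₀..θ, 1 / (ρ e τ) ^ 2

/-- The in-plane fundamental matrix `Φ_θ` of the Tschauner–Hempel system. -/
def Φ (e θ₀ θ : ℝ) : Matrix (Fin 4) (Fin 4) ℝ :=
  Matrix.of
    ![![1, -c e θ * (1 + 1 / ρ e θ), s e θ * (1 + 1 / ρ e θ),
        3 * (ρ e θ) ^ 2 * J e θ₀ θ],
      ![0, s e θ, c e θ, 2 - 3 * e * s e θ * J e θ₀ θ],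
      ![0, 2 * s e θ, 2 * c e θ - e, 3 * (1 - 2 * e * s e θ * J e θ₀ θ)],
      ![0, s' e θ, c' e θ, -3 * e * (s' e θ * J e θ₀ θ + s e θ / (ρ e θ) ^ 2)]]

/-- `A(θ)`: companion matrix of the in-plane Tschauner–Hempel system. -/
def A (e θ : ℝ) : Matrix (Fin 4) (Fin 4) ℝ :=
  Matrix.of
    ![![0, 0, 1, 0],
      ![0, 0, 0, 1],
      ![0, 0, 0, 2],
      ![0, 3 / ρ e θ, -2, 0]]

theorem ρ_pos {e : ℝ} (he : |e| < 1) (θ : ℝ) : 0 < ρ e θ := by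
  have h : |e * Real.cos θ| < 1 := by
    rw [abs_mul]
    exact (mul_le_of_le_one_right (abs_nonneg e) (Real.abs_cos_le_one θ)).trans_lt he
  unfold ρ
  linarith [(abs_lt.mp h).1]

theorem hasDerivAt_ρ (e θ : ℝ) : HasDerivAt (ρ e) (-(e * Real.sin θ)) θ := by
  refine (((Real.hasDerivAt_cos θ).const_mul e).const_add 1).congr_deriv ?_
  ring

theorem hasDerivAt_s (e θ : ℝ) : HasDerivAt (s e) (s' e θ) θ := by
  refine ((hasDerivAt_ρ e θ).mul (Real.hasDerivAt_sin θ)).congr_deriv ?_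
  simp only [s', ρ, Real.cos_two_mul]
  linear_combination -e * Real.sin_sq_add_cos_sq θ

theorem hasDerivAt_c (e θ : ℝ) : HasDerivAt (c e) (c' e θ) θ := by
  refine ((hasDerivAt_ρ e θ).mul (Real.hasDerivAt_cos θ)).congr_deriv ?_
  simp only [c', ρ, Real.sin_two_mul]
  ring

theorem hasDerivAt_s' (e θ : ℝ) (hρ : ρ e θ ≠ 0) :
    HasDerivAt (s' e) (3 / ρ e θ * s e θ - 4 * s e θ) θ := by
  have h2 : HasDerivAt (fun t : ℝ => 2 * t) 2 θ := by
    simpa using (hasDerivAt_id θ).const_mul (2 : ℝ)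
  refine ((Real.hasDerivAt_cos θ).add (h2.cos.const_mul e)).congr_deriv ?_
  rw [s, ← mul_assoc (3 / ρ e θ), div_mul_cancel₀ _ hρ, Real.sin_two_mul, ρ]
  ring

theorem hasDerivAt_c' (e θ : ℝ) (hρ : ρ e θ ≠ 0) :
    HasDerivAt (c' e) (3 / ρ e θ * c e θ - 2 * (2 * c e θ - e)) θ := by
  have h2 : HasDerivAt (fun t : ℝ => 2 * t) 2 θ := by
    simpa using (hasDerivAt_id θ).const_mul (2 : ℝ)
  refine ((Real.hasDerivAt_sin θ).add (h2.sin.const_mul e)).neg.congr_deriv ?_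
  rw [c, ← mul_assoc (3 / ρ e θ), div_mul_cancel₀ _ hρ, Real.cos_two_mul, ρ]
  ring

theorem hasDerivAt_J {e : ℝ} (he : |e| < 1) (θ₀ θ : ℝ) :
    HasDerivAt (J e θ₀) (1 / ρ e θ ^ 2) θ := by
  have hρ : Continuous (ρ e) := by unfold ρ; fun_prop
  have h : Continuous fun τ => 1 / ρ e τ ^ 2 :=
    continuous_const.div (hρ.pow 2) fun τ => pow_ne_zero 2 (ρ_pos he τ).ne'
  exact h.integral_hasStrictDerivAt θ₀ θ |>.hasDerivAt

theorem s'_eq (e θ : ℝ) : s' e θ = ρ e θ * Real.cos θ - e * Real.sin θ ^ 2 := by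
  rw [s', ρ, Real.cos_two_mul]
  linear_combination e * Real.sin_sq_add_cos_sq θ

theorem mul_one_add_one_div {r : ℝ} (hr : r ≠ 0) (x : ℝ) : r * x * (1 + 1 / r) = r * x + x := by
  field_simp

/-- Every entry of `Φ` is differentiable in `θ` and `Φ′(θ) = A(θ) Φ(θ)`. -/
theorem fundamental_matrix_satisfies_ODE (e : ℝ) (he : |e| < 1) (θ₀ : ℝ) :
    ∀ (θ : ℝ) (i j : Fin 4),
      HasDerivAt (fun t => Φ e θ₀ t i j) ((A e θ * Φ e θ₀ θ) i j) θ := by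
  intro θ i j
  have hne : ∀ t, ρ e t ≠ 0 := fun t => (ρ_pos he t).ne'
  have hρ := hasDerivAt_ρ e θ
  have hs := hasDerivAt_s e θ
  have hc := hasDerivAt_c e θ
  have hs' := hasDerivAt_s' e θ (hne θ)
  have hc' := hasDerivAt_c' e θ (hne θ)
  have hJ := hasDerivAt_J he θ₀ θ
  have hsJ := hs.mul hJ
  fin_cases i <;> fin_cases j <;>
    simp [Φ, A, Matrix.mul_apply, Fin.sum_univ_four, -one_div, -mul_eq_mul_left_iff] <;>
    try exact hasDerivAt_const _ _
  · simp only [c, mul_one_add_one_div (hne _)]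
    refine (hc.add (Real.hasDerivAt_cos θ)).neg.congr_deriv ?_
    rw [c', s, ρ, Real.sin_two_mul]
    ring
  · simp only [s, mul_one_add_one_div (hne _)]
    refine (hs.add (Real.hasDerivAt_sin θ)).congr_deriv ?_
    rw [s', c, ρ, Real.cos_two_mul]
    ring
  · refine (((hρ.pow 2).const_mul 3).mul hJ).congr_deriv ?_
    have := hne θ
    simp only [s, Pi.pow_apply]
    field_simp
    ring
  · exact hs
  · exact hc
  · simp only [mul_assoc]
    refine (((hsJ.const_mul e).const_mul 3).const_sub 2).congr_deriv ?_
    ring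
  · exact hs.const_mul 2
  · exact hc.const_mul 2
  · simp only [mul_assoc]
    refine ((((hsJ.const_mul e).const_mul 2).const_sub 1).const_mul 3).congr_deriv ?_
    ring
  · refine hs'.congr_deriv ?_
    ring
  · exact hc'
  · refine (((hs'.mul hJ).add (hs.div (hρ.pow 2) (pow_ne_zero 2 (hne θ)))).const_mul
      (3 * e)).neg.congr_deriv ?_
    have := hne θ
    have hcos : e * Real.cos θ = ρ e θ - 1 := by rw [ρ]; ring
    simp only [s'_eq, s, Pi.pow_apply]
    field_simp
    linear_combination (-2 * ρ e θ ^ 2) * hcos
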